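/- The Gauss map G of the meridian surface M² is harmonic (ΔG = 0 identically on I × J) if and only if κ ≡ 0, κ_α ≡ 0 and g' ≡ 0; in this case M² is totally geodesic and the image of z lies in a 2-dimensional affine plane of ℝ⁴, i.e. M² is part of a plane. -/

import Mathlib

open Matrix

noncomputable section

/-- The embedding of `ℝ³ = span{e₁,e₂,e₃}` into `ℝ⁴`. -/
def emb (p : Fin 3 → ℝ) : Fin 4 → ℝ := ![p 0, p 1, p 2, 0]

/-- The fourth standard basis vector `e₄` of `ℝ⁴`. -/
def e4 : Fin 4 → ℝ := ![0, 0, 0, 1]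

/-- Model of the bivector `a ∧ b ∈ Λ²ℝ⁴` as the antisymmetric matrix `aᵢbⱼ − aⱼbᵢ`. -/
def wedge (a b : Fin 4 → ℝ) : Fin 4 → Fin 4 → ℝ := fun i j => a i * b j - a j * b i

/-- The tangent `t = r'` of the spherical curve `r`. -/
def sphT (r : ℝ → Fin 3 → ℝ) : ℝ → Fin 3 → ℝ := deriv r

/-- The normal `n = r × t` of the spherical curve `r`. -/
def sphN (r : ℝ → Fin 3 → ℝ) (v : ℝ) : Fin 3 → ℝ := crossProduct (r v) (deriv r v)

/-- The spherical curvature `κ = ⟨t', n⟩` of the spherical curve `r`. -/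
def sphCurv (r : ℝ → Fin 3 → ℝ) (v : ℝ) : ℝ := deriv (deriv r) v ⬝ᵥ sphN r v

/-- The curvature `κ_α = f′g″ − g′f″` of the meridian curve `α = (f, g)`. -/
def merCurv (f g : ℝ → ℝ) (u : ℝ) : ℝ :=
  deriv f u * deriv (deriv g) u - deriv g u * deriv (deriv f) u

/-- The parametrization `z(u,v) = f(u) r(v) + g(u) e₄` of the meridian surface `M²`. -/
def mz (f g : ℝ → ℝ) (r : ℝ → Fin 3 → ℝ) (u v : ℝ) : Fin 4 → ℝ :=
  f u • emb (r v) + g u • e4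

/-- The tangent frame vector `x = ∂z/∂u = f′ r + g′ e₄`. -/
def mx (f g : ℝ → ℝ) (r : ℝ → Fin 3 → ℝ) (u v : ℝ) : Fin 4 → ℝ :=
  deriv f u • emb (r v) + deriv g u • e4

/-- The tangent frame vector `y = (1/f) ∂z/∂v = t`. -/
def my (r : ℝ → Fin 3 → ℝ) (v : ℝ) : Fin 4 → ℝ := emb (deriv r v)

/-- The normal frame vector `n₁ = n`. -/
def mn1 (r : ℝ → Fin 3 → ℝ) (v : ℝ) : Fin 4 → ℝ := emb (sphN r v)

/-- The normal frame vector `n₂ = −g′ r + f′ e₄`. -/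
def mn2 (f g : ℝ → ℝ) (r : ℝ → Fin 3 → ℝ) (u v : ℝ) : Fin 4 → ℝ :=
  (-(deriv g u)) • emb (r v) + deriv f u • e4

/-- The Gauss map `G = x ∧ y` of the meridian surface, with values in `Λ²ℝ⁴`. -/
def gaussG (f g : ℝ → ℝ) (r : ℝ → Fin 3 → ℝ) (u v : ℝ) : Fin 4 → Fin 4 → ℝ :=
  wedge (mx f g r u v) (my r v)

/-- The Laplacian `Δφ = −(∂²φ/∂u² + (1/f²) ∂²φ/∂v² + (f′/f) ∂φ/∂u)` of the meridian
surface, acting on `Λ²ℝ⁴`-valued functions. -/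
def surfLap (f : ℝ → ℝ) (φ : ℝ → ℝ → Fin 4 → Fin 4 → ℝ) (u v : ℝ) : Fin 4 → Fin 4 → ℝ :=
  -(deriv (deriv (fun s => φ s v)) u + (1 / f u ^ 2) • deriv (deriv (fun s => φ u s)) v
    + (deriv f u / f u) • deriv (fun s => φ s v) u)

/-- `h(x,x)`: the normal component (w.r.t. `{n₁, n₂}`) of `∇′ₓx = ∂x/∂u`. -/
def hxx (f g : ℝ → ℝ) (r : ℝ → Fin 3 → ℝ) (u v : ℝ) : Fin 4 → ℝ :=
  (deriv (fun s => mx f g r s v) u ⬝ᵥ mn1 r v) • mn1 r v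
    + (deriv (fun s => mx f g r s v) u ⬝ᵥ mn2 f g r u v) • mn2 f g r u v

/-- `h(x,y)`: the normal component (w.r.t. `{n₁, n₂}`) of `∇′_y x = (1/f) ∂x/∂v`. -/
def hxy (f g : ℝ → ℝ) (r : ℝ → Fin 3 → ℝ) (u v : ℝ) : Fin 4 → ℝ :=
  (((1 / f u) • deriv (fun s => mx f g r u s) v) ⬝ᵥ mn1 r v) • mn1 r v
    + (((1 / f u) • deriv (fun s => mx f g r u s) v) ⬝ᵥ mn2 f g r u v) • mn2 f g r u v

/-- `h(y,y)`: the normal component (w.r.t. `{n₁, n₂}`) of `∇′_y y = (1/f) ∂y/∂v`. -/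
def hyy (f g : ℝ → ℝ) (r : ℝ → Fin 3 → ℝ) (u v : ℝ) : Fin 4 → ℝ :=
  (((1 / f u) • deriv (my r) v) ⬝ᵥ mn1 r v) • mn1 r v
    + (((1 / f u) • deriv (my r) v) ⬝ᵥ mn2 f g r u v) • mn2 f g r u v


open Set Filter Topology

theorem deriv_eq_zero_of_eqOn_const {E : Type*} [NormedAddCommGroup E] [NormedSpace ℝ E]
    {S : Set ℝ} (hS : IsOpen S) {h : ℝ → E} {c : E} (hc : ∀ x ∈ S, h x = c) {x : ℝ}
    (hx : x ∈ S) : deriv h x = 0 := by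
  have : h =ᶠ[𝓝 x] fun _ => c := by
    filter_upwards [hS.mem_nhds hx] with y hy using hc y hy
  rw [this.deriv_eq, deriv_const]

theorem hasDerivAt_deriv_of_contDiffOn {E : Type*} [NormedAddCommGroup E] [NormedSpace ℝ E]
    {S : Set ℝ} (hS : IsOpen S) {h : ℝ → E} (hh : ContDiffOn ℝ (⊤ : ℕ∞) h S) {x : ℝ}
    (hx : x ∈ S) : HasDerivAt h (deriv h x) x :=
  ((hh.contDiffAt (hS.mem_nhds hx)).differentiableAt (by simp)).hasDerivAt

theorem contDiffOn_deriv {E : Type*} [NormedAddCommGroup E] [NormedSpace ℝ E]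
    {S : Set ℝ} (hS : IsOpen S) {h : ℝ → E} (hh : ContDiffOn ℝ (⊤ : ℕ∞) h S) :
    ContDiffOn ℝ (⊤ : ℕ∞) (deriv h) S :=
  hh.deriv_of_isOpen hS (by simp)

theorem hasDerivAt_dotProduct {ι : Type*} [Fintype ι] {a b : ℝ → ι → ℝ} {a' b' : ι → ℝ} {x : ℝ}
    (ha : HasDerivAt a a' x) (hb : HasDerivAt b b' x) :
    HasDerivAt (fun s => a s ⬝ᵥ b s) (a' ⬝ᵥ b x + a x ⬝ᵥ b') x := by
  simp only [dotProduct, ← Finset.sum_add_distrib]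
  exact HasDerivAt.fun_sum fun i _ => (hasDerivAt_pi.1 ha i).mul (hasDerivAt_pi.1 hb i)

/-- If `a ⬝ᵥ b` is constant on an open set, its derivative vanishes there. -/
theorem dotProduct_deriv_eq_zero {ι : Type*} [Fintype ι] {S : Set ℝ} (hS : IsOpen S)
    {a b : ℝ → ι → ℝ} (ha : ContDiffOn ℝ (⊤ : ℕ∞) a S) (hb : ContDiffOn ℝ (⊤ : ℕ∞) b S) {c : ℝ}
    (hc : ∀ x ∈ S, a x ⬝ᵥ b x = c) {x : ℝ} (hx : x ∈ S) :
    deriv a x ⬝ᵥ b x + a x ⬝ᵥ deriv b x = 0 := by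
  rw [← (hasDerivAt_dotProduct (hasDerivAt_deriv_of_contDiffOn hS ha hx)
    (hasDerivAt_deriv_of_contDiffOn hS hb hx)).deriv]
  exact deriv_eq_zero_of_eqOn_const hS hc hx

theorem hasDerivAt_emb {p : ℝ → Fin 3 → ℝ} {p' : Fin 3 → ℝ} {x : ℝ} (hp : HasDerivAt p p' x) :
    HasDerivAt (fun s => emb (p s)) (emb p') x := by
  have h := hasDerivAt_pi.1 hp
  rw [hasDerivAt_pi]
  intro i
  fin_cases i
  · exact h 0
  · exact h 1
  · exact h 2
  · exact hasDerivAt_const x 0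

theorem contDiff_emb : ContDiff ℝ (⊤ : ℕ∞) emb := by
  rw [contDiff_pi]
  intro i
  fin_cases i <;> simp [emb] <;> fun_prop

theorem hasDerivAt_wedge {a b : ℝ → Fin 4 → ℝ} {a' b' : Fin 4 → ℝ} {x : ℝ}
    (ha : HasDerivAt a a' x) (hb : HasDerivAt b b' x) :
    HasDerivAt (fun s => wedge (a s) (b s)) (wedge a' (b x) + wedge (a x) b') x := by
  rw [hasDerivAt_pi]
  intro i
  rw [hasDerivAt_pi]
  intro j
  have ha := hasDerivAt_pi.1 ha
  have hb := hasDerivAt_pi.1 hb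
  convert! ((ha i).mul (hb j)).sub ((ha j).mul (hb i)) using 1
  simp only [wedge, Pi.add_apply]
  ring

theorem contDiffOn_wedge {S : Set ℝ} {a b : ℝ → Fin 4 → ℝ} (ha : ContDiffOn ℝ (⊤ : ℕ∞) a S)
    (hb : ContDiffOn ℝ (⊤ : ℕ∞) b S) :
    ContDiffOn ℝ (⊤ : ℕ∞) (fun s => wedge (a s) (b s)) S := by
  rw [contDiffOn_pi]
  intro i
  rw [contDiffOn_pi]
  intro j
  have ha := contDiffOn_pi.1 ha
  have hb := contDiffOn_pi.1 hb
  exact ((ha i).mul (hb j)).sub ((ha j).mul (hb i))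

/-- A curve of matrices of constant Frobenius norm satisfies `⟨φ, φ''⟩ = -|φ'|²`. -/
theorem sum_mul_deriv_deriv {ι κ : Type*} [Fintype ι] [Fintype κ] {S : Set ℝ} (hS : IsOpen S)
    {φ : ℝ → ι → κ → ℝ} (hφ : ContDiffOn ℝ (⊤ : ℕ∞) φ S) {c : ℝ}
    (hc : ∀ x ∈ S, ∑ i, ∑ j, φ x i j * φ x i j = c) {x : ℝ} (hx : x ∈ S) :
    ∑ i, ∑ j, φ x i j * deriv φ x i j = 0 ∧
      ∑ i, ∑ j, φ x i j * deriv (deriv φ) x i j = -∑ i, ∑ j, deriv φ x i j ^ 2 := by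
  have h1 : ∀ y ∈ S, ∀ i j, HasDerivAt (fun s => φ s i j) (deriv φ y i j) y := fun y hy i j =>
    hasDerivAt_pi.1 (hasDerivAt_pi.1 (hasDerivAt_deriv_of_contDiffOn hS hφ hy) i) j
  have h2 : ∀ y ∈ S, ∀ i j, HasDerivAt (fun s => deriv φ s i j) (deriv (deriv φ) y i j) y :=
    fun y hy i j => hasDerivAt_pi.1 (hasDerivAt_pi.1
      (hasDerivAt_deriv_of_contDiffOn hS (contDiffOn_deriv hS hφ) hy) i) j
  have e1 : ∀ y ∈ S, ∑ i, ∑ j, φ y i j * deriv φ y i j = 0 := by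
    intro y hy
    have := (HasDerivAt.fun_sum (u := Finset.univ) fun i _ =>
      HasDerivAt.fun_sum (u := Finset.univ) fun j _ => (h1 y hy i j).fun_mul (h1 y hy i j)).deriv
    rw [deriv_eq_zero_of_eqOn_const hS hc hy] at this
    have e : ∀ i j, deriv φ y i j * φ y i j + φ y i j * deriv φ y i j
        = 2 * (φ y i j * deriv φ y i j) := fun i j => by ring
    simp only [e, ← Finset.mul_sum] at this
    linarith
  refine ⟨e1 x hx, ?_⟩
  have := (HasDerivAt.fun_sum (u := Finset.univ) fun i _ =>
    HasDerivAt.fun_sum (u := Finset.univ) fun j _ => (h1 x hx i j).fun_mul (h2 x hx i j)).deriv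
  rw [deriv_eq_zero_of_eqOn_const hS e1 hx] at this
  simp only [← sq, Finset.sum_add_distrib] at this
  linarith

/-- Expansion of a vector of `ℝ³` in the orthonormal frame `a, b, a × b`. -/
theorem eq_orthonormal_expansion {a b : Fin 3 → ℝ} (haa : a ⬝ᵥ a = 1) (hbb : b ⬝ᵥ b = 1)
    (hab : a ⬝ᵥ b = 0) (w : Fin 3 → ℝ) :
    w = (w ⬝ᵥ a) • a + (w ⬝ᵥ b) • b + (w ⬝ᵥ crossProduct a b) • crossProduct a b := by
  have key : (a ⬝ᵥ a * b ⬝ᵥ b - (a ⬝ᵥ b) ^ 2) • w =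
      (w ⬝ᵥ crossProduct a b) • crossProduct a b
        + (w ⬝ᵥ b) • ((a ⬝ᵥ a) • b - (a ⬝ᵥ b) • a)
        - (w ⬝ᵥ a) • ((a ⬝ᵥ b) • b - (b ⬝ᵥ b) • a) := by
    ext i
    fin_cases i <;>
      simp [cross_apply, dotProduct, Fin.sum_univ_three,
        vecHead, vecTail] <;> ring
  rw [haa, hbb, hab] at key
  ext i
  have := congrFun key i
  simp at this ⊢
  linarith

theorem emb_add_smul (c d : ℝ) (p q : Fin 3 → ℝ) :
    emb (c • p + d • q) = c • emb p + d • emb q := by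
  ext i
  fin_cases i <;> simp [emb]

theorem emb_dotProduct_emb (p q : Fin 3 → ℝ) : emb p ⬝ᵥ emb q = p ⬝ᵥ q := by
  simp [emb, dotProduct, Fin.sum_univ_succ]

theorem emb_dotProduct_e4 (p : Fin 3 → ℝ) : emb p ⬝ᵥ e4 = 0 := by
  simp [emb, e4, dotProduct, Fin.sum_univ_succ]

theorem e4_dotProduct_e4 : e4 ⬝ᵥ e4 = 1 := by
  simp [e4, dotProduct, Fin.sum_univ_succ]

theorem sum_wedge_mul_self (a b : Fin 4 → ℝ) :
    ∑ i, ∑ j, wedge a b i j * wedge a b i j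
      = 2 * (a ⬝ᵥ a * b ⬝ᵥ b - (a ⬝ᵥ b) ^ 2) := by
  simp only [wedge, dotProduct, Fin.sum_univ_four]
  ring

theorem wedge_smul_self (c : ℝ) (a : Fin 4 → ℝ) : wedge (c • a) a = 0 := by
  ext i j
  simp [wedge]
  ring

theorem dotProduct_crossProduct_eq_zero_of_parallel {a w : Fin 3 → ℝ}
    (h : ∀ i j, a i * w j = a j * w i) (b : Fin 3 → ℝ) : w ⬝ᵥ crossProduct a b = 0 := by
  simp [cross_apply, dotProduct, Fin.sum_univ_three]
  linear_combination b 2 * h 1 0 + b 0 * h 2 1 + b 1 * h 0 2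

section MeridianSurface

variable {I J : Set ℝ} {r : ℝ → Fin 3 → ℝ} {f g : ℝ → ℝ}

theorem sph_dotProduct_deriv (hJ : IsOpen J) (hr : ContDiffOn ℝ (⊤ : ℕ∞) r J)
    (hrs : ∀ v ∈ J, r v ⬝ᵥ r v = 1) {v : ℝ} (hv : v ∈ J) : r v ⬝ᵥ deriv r v = 0 := by
  have := dotProduct_deriv_eq_zero hJ hr hr hrs hv
  rw [dotProduct_comm (deriv r v)] at this
  linarith

theorem sph_dotProduct_deriv_deriv (hJ : IsOpen J) (hr : ContDiffOn ℝ (⊤ : ℕ∞) r J)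
    (hrs : ∀ v ∈ J, r v ⬝ᵥ r v = 1) (hra : ∀ v ∈ J, deriv r v ⬝ᵥ deriv r v = 1)
    {v : ℝ} (hv : v ∈ J) : deriv (deriv r) v ⬝ᵥ r v = -1 := by
  have := dotProduct_deriv_eq_zero hJ hr (contDiffOn_deriv hJ hr)
    (fun v hv => sph_dotProduct_deriv hJ hr hrs hv) hv
  rw [hra v hv, dotProduct_comm (r v)] at this
  linarith

theorem sph_deriv_deriv_eq_neg (hJ : IsOpen J) (hr : ContDiffOn ℝ (⊤ : ℕ∞) r J)
    (hrs : ∀ v ∈ J, r v ⬝ᵥ r v = 1) (hra : ∀ v ∈ J, deriv r v ⬝ᵥ deriv r v = 1)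
    {v : ℝ} (hv : v ∈ J) (hκ : sphCurv r v = 0) : deriv (deriv r) v = -r v := by
  have hT := contDiffOn_deriv hJ hr
  have h := dotProduct_deriv_eq_zero hJ hT hT hra hv
  rw [dotProduct_comm (deriv r v)] at h
  have h0 : deriv (deriv r) v ⬝ᵥ deriv r v = 0 := by linarith
  have hκ' : deriv (deriv r) v ⬝ᵥ crossProduct (r v) (deriv r v) = 0 := hκ
  have e := eq_orthonormal_expansion (hrs v hv) (hra v hv) (sph_dotProduct_deriv hJ hr hrs hv)
    (deriv (deriv r) v)
  rw [sph_dotProduct_deriv_deriv hJ hr hrs hra hv, h0, hκ'] at e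
  simpa using e

theorem sphN_const (hJ : IsOpen J) (hJiv : J.OrdConnected) (hr : ContDiffOn ℝ (⊤ : ℕ∞) r J)
    (hrs : ∀ v ∈ J, r v ⬝ᵥ r v = 1) (hra : ∀ v ∈ J, deriv r v ⬝ᵥ deriv r v = 1)
    (hκ : ∀ v ∈ J, sphCurv r v = 0) {v w : ℝ} (hv : v ∈ J) (hw : w ∈ J) :
    sphN r v = sphN r w := by
  have hd : ∀ v ∈ J, HasDerivAt (sphN r) 0 v := by
    intro v hv
    have h1 := hasDerivAt_pi.1 (hasDerivAt_deriv_of_contDiffOn hJ hr hv)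
    have h2 := hasDerivAt_deriv_of_contDiffOn hJ (contDiffOn_deriv hJ hr) hv
    rw [sph_deriv_deriv_eq_neg hJ hr hrs hra hv (hκ v hv)] at h2
    replace h2 := hasDerivAt_pi.1 h2
    have H : ∀ i j, HasDerivAt (fun s => r s i * deriv r s j - r s j * deriv r s i) 0 v := by
      intro i j
      convert! ((h1 i).mul (h2 j)).sub ((h1 j).mul (h2 i)) using 1
      simp only [Pi.neg_apply]
      ring
    rw [hasDerivAt_pi]
    intro i
    unfold sphN
    fin_cases i <;> simp [cross_apply]
    exacts [H 1 2, H 2 0, H 0 1]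
  exact hJ.is_const_of_deriv_eq_zero hJiv.isPreconnected
    (fun v hv => (hd v hv).differentiableAt.differentiableWithinAt)
    (fun v hv => (hd v hv).deriv) hv hw

theorem hasDerivAt_mx_fst (hI : IsOpen I) (hf : ContDiffOn ℝ (⊤ : ℕ∞) f I)
    (hg : ContDiffOn ℝ (⊤ : ℕ∞) g I) {u : ℝ} (hu : u ∈ I) (v : ℝ) :
    HasDerivAt (fun s => mx f g r s v)
      (deriv (deriv f) u • emb (r v) + deriv (deriv g) u • e4) u :=
  ((hasDerivAt_deriv_of_contDiffOn hI (contDiffOn_deriv hI hf) hu).smul_const _).add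
    ((hasDerivAt_deriv_of_contDiffOn hI (contDiffOn_deriv hI hg) hu).smul_const _)

theorem hasDerivAt_mx_snd (hJ : IsOpen J) (hr : ContDiffOn ℝ (⊤ : ℕ∞) r J) (u : ℝ) {v : ℝ}
    (hv : v ∈ J) : HasDerivAt (fun s => mx f g r u s) (deriv f u • my r v) v :=
  ((hasDerivAt_emb (hasDerivAt_deriv_of_contDiffOn hJ hr hv)).fun_const_smul (deriv f u)).add_const
    (deriv g u • e4)

theorem hasDerivAt_my (hJ : IsOpen J) (hr : ContDiffOn ℝ (⊤ : ℕ∞) r J) {v : ℝ} (hv : v ∈ J) :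
    HasDerivAt (my r) (emb (deriv (deriv r) v)) v :=
  hasDerivAt_emb (hasDerivAt_deriv_of_contDiffOn hJ (contDiffOn_deriv hJ hr) hv)

theorem hasDerivAt_gaussG_fst (hI : IsOpen I) (hf : ContDiffOn ℝ (⊤ : ℕ∞) f I)
    (hg : ContDiffOn ℝ (⊤ : ℕ∞) g I) {u : ℝ} (hu : u ∈ I) (v : ℝ) :
    HasDerivAt (fun s => gaussG f g r s v)
      (wedge (deriv (deriv f) u • emb (r v) + deriv (deriv g) u • e4) (my r v)) u := by
  convert! hasDerivAt_wedge (hasDerivAt_mx_fst hI hf hg hu v) (hasDerivAt_const u (my r v)) using 1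
  ext i j
  simp [wedge]

theorem hasDerivAt_gaussG_snd (hJ : IsOpen J) (hr : ContDiffOn ℝ (⊤ : ℕ∞) r J) (u : ℝ) {v : ℝ}
    (hv : v ∈ J) : HasDerivAt (fun s => gaussG f g r u s)
      (wedge (mx f g r u v) (emb (deriv (deriv r) v))) v := by
  have := hasDerivAt_wedge (hasDerivAt_mx_snd (f := f) (g := g) hJ hr u hv) (hasDerivAt_my hJ hr hv)
  rwa [wedge_smul_self, zero_add] at this

theorem contDiffOn_gaussG_fst (hI : IsOpen I) (hf : ContDiffOn ℝ (⊤ : ℕ∞) f I)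
    (hg : ContDiffOn ℝ (⊤ : ℕ∞) g I) (v : ℝ) :
    ContDiffOn ℝ (⊤ : ℕ∞) (fun s => gaussG f g r s v) I :=
  contDiffOn_wedge (((contDiffOn_deriv hI hf).smul contDiffOn_const).add
    ((contDiffOn_deriv hI hg).smul contDiffOn_const)) contDiffOn_const

theorem contDiffOn_gaussG_snd (hJ : IsOpen J) (hr : ContDiffOn ℝ (⊤ : ℕ∞) r J) (u : ℝ) :
    ContDiffOn ℝ (⊤ : ℕ∞) (fun s => gaussG f g r u s) J :=
  contDiffOn_wedge (((contDiffOn_const (c := deriv f u)).smul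
    (contDiff_emb.comp_contDiffOn hr)).add (contDiffOn_const (c := deriv g u • e4)))
    (contDiff_emb.comp_contDiffOn (contDiffOn_deriv hJ hr))

theorem sum_gaussG_mul_self (hJ : IsOpen J) (hr : ContDiffOn ℝ (⊤ : ℕ∞) r J)
    (hrs : ∀ v ∈ J, r v ⬝ᵥ r v = 1) (hra : ∀ v ∈ J, deriv r v ⬝ᵥ deriv r v = 1)
    (hfg : ∀ u ∈ I, deriv f u ^ 2 + deriv g u ^ 2 = 1) {u v : ℝ} (hu : u ∈ I) (hv : v ∈ J) :
    ∑ i, ∑ j, gaussG f g r u v i j * gaussG f g r u v i j = 2 := by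
  have hxx : mx f g r u v ⬝ᵥ mx f g r u v = 1 := by
    simp only [mx, add_dotProduct, dotProduct_add, smul_dotProduct, dotProduct_smul,
      emb_dotProduct_emb, emb_dotProduct_e4, dotProduct_comm e4 (emb _), e4_dotProduct_e4,
      hrs v hv, smul_eq_mul]
    linear_combination hfg u hu
  have hxy : mx f g r u v ⬝ᵥ my r v = 0 := by
    simp [mx, my, add_dotProduct, smul_dotProduct, emb_dotProduct_emb, emb_dotProduct_e4,
      dotProduct_comm e4 (emb _), sph_dotProduct_deriv hJ hr hrs hv]
  have hyy : my r v ⬝ᵥ my r v = 1 := by rw [my, emb_dotProduct_emb, hra v hv]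
  rw [gaussG, sum_wedge_mul_self, hxx, hxy, hyy]
  norm_num

/-- A harmonic Gauss map does not vary along the parallels, since `⟨ΔG, G⟩ = |∇G|²`. -/
theorem deriv_gaussG_snd_eq_zero (hI : IsOpen I) (hJ : IsOpen J)
    (hr : ContDiffOn ℝ (⊤ : ℕ∞) r J)
    (hrs : ∀ v ∈ J, r v ⬝ᵥ r v = 1) (hra : ∀ v ∈ J, deriv r v ⬝ᵥ deriv r v = 1)
    (hf : ContDiffOn ℝ (⊤ : ℕ∞) f I) (hg : ContDiffOn ℝ (⊤ : ℕ∞) g I)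
    (hf0 : ∀ u ∈ I, f u ≠ 0) (hfg : ∀ u ∈ I, deriv f u ^ 2 + deriv g u ^ 2 = 1)
    {u v : ℝ} (hu : u ∈ I) (hv : v ∈ J) (hΔ : surfLap f (gaussG f g r) u v = 0) :
    deriv (fun s => gaussG f g r u s) v = 0 := by
  obtain ⟨h1, h2⟩ := sum_mul_deriv_deriv hI (contDiffOn_gaussG_fst (r := r) hI hf hg v)
    (fun u hu => sum_gaussG_mul_self hJ hr hrs hra hfg hu hv) hu
  obtain ⟨-, h3⟩ := sum_mul_deriv_deriv hJ (contDiffOn_gaussG_snd (f := f) (g := g) hJ hr u)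
    (fun v hv => sum_gaussG_mul_self hJ hr hrs hra hfg hu hv) hv
  have h4 : ∑ i, ∑ j, gaussG f g r u v i j * surfLap f (gaussG f g r) u v i j = 0 := by
    simp [hΔ]
  simp only [surfLap, Pi.neg_apply, Pi.add_apply, Pi.smul_apply, smul_eq_mul, mul_neg, mul_add,
    mul_left_comm _ (1 / f u ^ 2), mul_left_comm _ (deriv f u / f u), Finset.sum_neg_distrib,
    Finset.sum_add_distrib, ← Finset.mul_sum, h1, h2, h3] at h4
  have hpos : 0 < 1 / f u ^ 2 := by
    have := hf0 u hu
    positivity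
  have hA : 0 ≤ ∑ i, ∑ j, deriv (fun s => gaussG f g r s v) u i j ^ 2 := by positivity
  have hB : 0 ≤ ∑ i, ∑ j, deriv (fun s => gaussG f g r u s) v i j ^ 2 := by positivity
  have hB0 : ∑ i, ∑ j, deriv (fun s => gaussG f g r u s) v i j ^ 2 = 0 := by
    by_contra hne
    have := mul_pos hpos (lt_of_le_of_ne hB (Ne.symm hne))
    linarith
  ext i j
  rw [Finset.sum_eq_zero_iff_of_nonneg fun _ _ => by positivity] at hB0
  have := hB0 i (Finset.mem_univ i)
  rw [Finset.sum_eq_zero_iff_of_nonneg fun _ _ => by positivity] at this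
  simpa using this j (Finset.mem_univ j)

theorem sphCurv_eq_zero_and_deriv_eq_zero (hJ : IsOpen J) (hr : ContDiffOn ℝ (⊤ : ℕ∞) r J)
    (hrs : ∀ v ∈ J, r v ⬝ᵥ r v = 1) (hra : ∀ v ∈ J, deriv r v ⬝ᵥ deriv r v = 1)
    (hfg : ∀ u ∈ I, deriv f u ^ 2 + deriv g u ^ 2 = 1) {u v : ℝ} (hu : u ∈ I) (hv : v ∈ J)
    (hG : deriv (fun s => gaussG f g r u s) v = 0) : sphCurv r v = 0 ∧ deriv g u = 0 := by
  rw [(hasDerivAt_gaussG_snd hJ hr u hv).deriv] at hG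
  have hw := sph_dotProduct_deriv_deriv hJ hr hrs hra hv
  have hG' : ∀ i j, wedge (mx f g r u v) (emb (deriv (deriv r) v)) i j = 0 := fun i j => by
    rw [hG]; rfl
  have hg0 : deriv g u = 0 := by
    have a0 := hG' 3 0
    have a1 := hG' 3 1
    have a2 := hG' 3 2
    simp only [dotProduct, Fin.sum_univ_three] at hw
    simp [wedge, mx, emb, e4, -mul_eq_zero] at a0 a1 a2
    linear_combination -r v 0 * a0 - r v 1 * a1 - r v 2 * a2 + deriv g u * hw
  refine ⟨?_, hg0⟩
  have hfu : deriv f u ≠ 0 := by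
    intro h
    have := hfg u hu
    rw [h, hg0] at this
    norm_num at this
  refine dotProduct_crossProduct_eq_zero_of_parallel (fun i j => ?_) _
  have hc : ∀ k : Fin 3, mx f g r u v k.castSucc = deriv f u * r v k := by
    intro k
    fin_cases k <;> simp [mx, emb, e4]
  have he : ∀ (p : Fin 3 → ℝ) (k : Fin 3), emb p k.castSucc = p k := by
    intro p k
    fin_cases k <;> simp [emb]
  have := hG' i.castSucc j.castSucc
  simp only [wedge, hc, he] at this
  apply mul_left_cancel₀ hfu
  linear_combination this

theorem deriv_deriv_fst_eq_zero (hI : IsOpen I) (hf : ContDiffOn ℝ (⊤ : ℕ∞) f I)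
    (hfg : ∀ u ∈ I, deriv f u ^ 2 + deriv g u ^ 2 = 1) (hg' : ∀ u ∈ I, deriv g u = 0)
    {u : ℝ} (hu : u ∈ I) : deriv (deriv f) u = 0 := by
  have h1 : ∀ u ∈ I, deriv f u ^ 2 = 1 := fun u hu => by simpa [hg' u hu] using hfg u hu
  have h2 := ((hasDerivAt_deriv_of_contDiffOn hI (contDiffOn_deriv hI hf) hu).fun_pow 2).deriv
  rw [deriv_eq_zero_of_eqOn_const hI h1 hu] at h2
  have h3 : deriv f u ≠ 0 := by
    intro h
    simpa [h] using h1 u hu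
  simpa [h3] using h2

theorem surfLap_gaussG_eq_zero (hI : IsOpen I) (hJ : IsOpen J)
    (hr : ContDiffOn ℝ (⊤ : ℕ∞) r J)
    (hrs : ∀ v ∈ J, r v ⬝ᵥ r v = 1) (hra : ∀ v ∈ J, deriv r v ⬝ᵥ deriv r v = 1)
    (hf : ContDiffOn ℝ (⊤ : ℕ∞) f I) (hg : ContDiffOn ℝ (⊤ : ℕ∞) g I)
    (hfg : ∀ u ∈ I, deriv f u ^ 2 + deriv g u ^ 2 = 1)
    (hκ : ∀ v ∈ J, sphCurv r v = 0) (hg' : ∀ u ∈ I, deriv g u = 0)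
    {u v : ℝ} (hu : u ∈ I) (hv : v ∈ J) : surfLap f (gaussG f g r) u v = 0 := by
  have hU : ∀ u ∈ I, deriv (fun s => gaussG f g r s v) u = 0 := by
    intro u hu
    rw [(hasDerivAt_gaussG_fst hI hf hg hu v).deriv, deriv_deriv_fst_eq_zero hI hf hfg hg' hu,
      deriv_eq_zero_of_eqOn_const hI hg' hu]
    ext i j
    simp [wedge]
  have hV : ∀ v ∈ J, deriv (fun s => gaussG f g r u s) v = 0 := by
    intro v hv
    rw [(hasDerivAt_gaussG_snd hJ hr u hv).deriv,
      sph_deriv_deriv_eq_neg hJ hr hrs hra hv (hκ v hv), mx, hg' u hu]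
    have := emb_add_smul (-1) 0 (r v) 0
    simp only [zero_smul, add_zero, neg_smul, one_smul] at this
    rw [this]
    ext i j
    simp [wedge]
    ring
  simp [surfLap, hU u hu, deriv_eq_zero_of_eqOn_const hI hU hu,
    deriv_eq_zero_of_eqOn_const hJ hV hv]

theorem second_fundamental_form_eq_zero (hI : IsOpen I) (hJ : IsOpen J)
    (hr : ContDiffOn ℝ (⊤ : ℕ∞) r J)
    (hf : ContDiffOn ℝ (⊤ : ℕ∞) f I) (hg : ContDiffOn ℝ (⊤ : ℕ∞) g I)
    (hfg : ∀ u ∈ I, deriv f u ^ 2 + deriv g u ^ 2 = 1)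
    (hκ : ∀ v ∈ J, sphCurv r v = 0) (hg' : ∀ u ∈ I, deriv g u = 0)
    {u v : ℝ} (hu : u ∈ I) (hv : v ∈ J) :
    hxx f g r u v = 0 ∧ hxy f g r u v = 0 ∧ hyy f g r u v = 0 := by
  refine ⟨?_, ?_, ?_⟩
  · rw [hxx, (hasDerivAt_mx_fst hI hf hg hu v).deriv, deriv_deriv_fst_eq_zero hI hf hfg hg' hu,
      deriv_eq_zero_of_eqOn_const hI hg' hu]
    simp
  · rw [hxy, (hasDerivAt_mx_snd hJ hr u hv).deriv, mn1, mn2, my, hg' u hu]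
    simp [emb_dotProduct_emb, emb_dotProduct_e4, sphN]
  · have hκ' : deriv (deriv r) v ⬝ᵥ sphN r v = 0 := hκ v hv
    rw [hyy, (hasDerivAt_my hJ hr hv).deriv, mn1, mn2, hg' u hu]
    simp [emb_dotProduct_emb, emb_dotProduct_e4, hκ']

theorem mz_mem_plane (hI : IsOpen I) (hIiv : I.OrdConnected) (hIne : I.Nonempty)
    (hJ : IsOpen J) (hJiv : J.OrdConnected) (hJne : J.Nonempty)
    (hr : ContDiffOn ℝ (⊤ : ℕ∞) r J)
    (hrs : ∀ v ∈ J, r v ⬝ᵥ r v = 1) (hra : ∀ v ∈ J, deriv r v ⬝ᵥ deriv r v = 1)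
    (hg : ContDiffOn ℝ (⊤ : ℕ∞) g I)
    (hκ : ∀ v ∈ J, sphCurv r v = 0) (hg' : ∀ u ∈ I, deriv g u = 0) :
    ∃ p d₁ d₂ : Fin 4 → ℝ, ∀ u ∈ I, ∀ v ∈ J, ∃ s t : ℝ,
      mz f g r u v = p + s • d₁ + t • d₂ := by
  obtain ⟨u₀, hu₀⟩ := hIne
  obtain ⟨v₀, hv₀⟩ := hJne
  refine ⟨g u₀ • e4, emb (r v₀), emb (deriv r v₀), fun u hu v hv =>
    ⟨f u * (r v ⬝ᵥ r v₀), f u * (r v ⬝ᵥ deriv r v₀), ?_⟩⟩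
  have hgc : g u = g u₀ := hI.is_const_of_deriv_eq_zero hIiv.isPreconnected
    (fun w hw => (hasDerivAt_deriv_of_contDiffOn hI hg hw).differentiableAt.differentiableWithinAt)
    hg' hu hu₀
  have hn : r v ⬝ᵥ crossProduct (r v₀) (deriv r v₀) = 0 := by
    have := sphN_const hJ hJiv hr hrs hra hκ hv₀ hv
    rw [sphN] at this
    rw [this, sphN, dot_self_cross]
  have e := eq_orthonormal_expansion (hrs v₀ hv₀) (hra v₀ hv₀)
    (sph_dotProduct_deriv hJ hr hrs hv₀) (r v)
  rw [hn, zero_smul, add_zero] at e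
  rw [mz, hgc]
  conv_lhs => rw [e, emb_add_smul]
  module

end MeridianSurface

/-- The Gauss map of a meridian surface is harmonic (`ΔG = 0`) iff
`κ ≡ 0`, `κ_α ≡ 0` and `g′ ≡ 0`; in this case `M²` is totally geodesic and is part of a
plane (the image of `z` lies in a 2-dimensional affine plane of `ℝ⁴`). -/
theorem meridian_surface_harmonic_gauss_map_iff_plane
    (I J : Set ℝ) (hI : IsOpen I) (hIiv : I.OrdConnected) (hIne : I.Nonempty)
    (hJ : IsOpen J) (hJiv : J.OrdConnected) (hJne : J.Nonempty)
    (r : ℝ → Fin 3 → ℝ) (hr : ContDiffOn ℝ (⊤ : ℕ∞) r J)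
    (hrs : ∀ v ∈ J, r v ⬝ᵥ r v = 1) (hra : ∀ v ∈ J, deriv r v ⬝ᵥ deriv r v = 1)
    (f g : ℝ → ℝ) (hf : ContDiffOn ℝ (⊤ : ℕ∞) f I) (hg : ContDiffOn ℝ (⊤ : ℕ∞) g I)
    (hf0 : ∀ u ∈ I, f u ≠ 0) (hfg : ∀ u ∈ I, deriv f u ^ 2 + deriv g u ^ 2 = 1) :
    ((∀ u ∈ I, ∀ v ∈ J, surfLap f (gaussG f g r) u v = 0) ↔
      ((∀ v ∈ J, sphCurv r v = 0) ∧ (∀ u ∈ I, merCurv f g u = 0) ∧ ∀ u ∈ I, deriv g u = 0)) ∧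
    ((∀ u ∈ I, ∀ v ∈ J, surfLap f (gaussG f g r) u v = 0) →
      ((∀ u ∈ I, ∀ v ∈ J, hxx f g r u v = 0 ∧ hxy f g r u v = 0 ∧ hyy f g r u v = 0) ∧
        ∃ p d₁ d₂ : Fin 4 → ℝ, ∀ u ∈ I, ∀ v ∈ J, ∃ s t : ℝ,
          mz f g r u v = p + s • d₁ + t • d₂)) := by
  have hκg : (∀ u ∈ I, ∀ v ∈ J, surfLap f (gaussG f g r) u v = 0) →
      (∀ v ∈ J, sphCurv r v = 0) ∧ ∀ u ∈ I, deriv g u = 0 := by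
    intro hΔ
    have h : ∀ u ∈ I, ∀ v ∈ J, sphCurv r v = 0 ∧ deriv g u = 0 := fun u hu v hv =>
      sphCurv_eq_zero_and_deriv_eq_zero hJ hr hrs hra hfg hu hv
        (deriv_gaussG_snd_eq_zero hI hJ hr hrs hra hf hg hf0 hfg hu hv (hΔ u hu v hv))
    obtain ⟨u₀, hu₀⟩ := hIne
    obtain ⟨v₀, hv₀⟩ := hJne
    exact ⟨fun v hv => (h u₀ hu₀ v hv).1, fun u hu => (h u hu v₀ hv₀).2⟩
  refine ⟨⟨fun hΔ => ?_, fun ⟨hκ, _, hg'⟩ u hu v hv =>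
    surfLap_gaussG_eq_zero hI hJ hr hrs hra hf hg hfg hκ hg' hu hv⟩, fun hΔ => ?_⟩
  · obtain ⟨hκ, hg'⟩ := hκg hΔ
    refine ⟨hκ, fun u hu => ?_, hg'⟩
    rw [merCurv, hg' u hu, deriv_eq_zero_of_eqOn_const hI hg' hu]
    ring
  · obtain ⟨hκ, hg'⟩ := hκg hΔ
    exact ⟨fun u hu v hv => second_fundamental_form_eq_zero hI hJ hr hf hg hfg hκ hg' hu hv,
      mz_mem_plane hI hIiv hIne hJ hJiv hJne hr hrs hra hg hκ hg'⟩
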